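/- For every finite simple graph G, χ_lid(G) ≤ χ_lid(G\R) + (T(G) − 1)·t(G). That is, if the maximal twin-free induced subgraph G\R of G admits a lid-coloring with n colors, then G admits a lid-coloring with at most n + (T(G) − 1)·t(G) colors. -/

import Mathlib

open SimpleGraph

variable {V : Type*}

/-- The closed neighborhood `N[u]` of a vertex `u`. -/
def closedNbhd (G : SimpleGraph V) (u : V) : Set V := insert u (G.neighborSet u)

/-- Two vertices are twins if they have the same closed neighborhood. -/
def Twins (G : SimpleGraph V) (u v : V) : Prop := closedNbhd G u = closedNbhd G v

/-- `c` is a locally identifying (lid-) coloring of `G`: a proper coloring such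
that every pair of adjacent non-twin vertices gets distinct color sets on their
closed neighborhoods. -/
def IsLidColoring {α : Type*} (G : SimpleGraph V) (c : V → α) : Prop :=
  (∀ u v : V, G.Adj u v → c u ≠ c v) ∧
  ∀ u v : V, G.Adj u v → ¬ Twins G u v → c '' closedNbhd G u ≠ c '' closedNbhd G v

/-- `χ_lid(G)`: the minimum number of colors in a lid-coloring of `G`. -/
noncomputable def chiLid (G : SimpleGraph V) : ℕ :=
  sInf {n | ∃ c : V → Fin n, IsLidColoring G c}

/-- `s` is a set of representatives of the twin-equivalence classes of `G`:
it contains exactly one vertex from each class. The induced subgraph of `G` on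
such a set is the maximal twin-free induced subgraph `G\R` (the quotient of `G`
by the twin relation `R`), well-defined up to isomorphism. -/
def IsRepSet (G : SimpleGraph V) (s : Finset V) : Prop :=
  ∀ v : V, ∃! w, w ∈ s ∧ Twins G v w

open Classical in
/-- The twin-equivalence class of a vertex, as a `Finset`. -/
noncomputable def twinClass (G : SimpleGraph V) [Fintype V] (v : V) : Finset V :=
  Finset.univ.filter (Twins G v)

open Classical in
/-- `t(G)`: the number of twin-equivalence classes with at least two vertices. -/
noncomputable def numBigTwinClasses (G : SimpleGraph V) [Fintype V] : ℕ :=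
  ((Finset.univ.image (twinClass G)).filter (fun Q => 2 ≤ Q.card)).card

/-- `T(G)`: the cardinality of a largest twin-equivalence class. -/
noncomputable def maxTwinClass (G : SimpleGraph V) [Fintype V] : ℕ :=
  Finset.univ.sup (fun v => (twinClass G v).card)

lemma mem_closedNbhd {G : SimpleGraph V} {u v : V} :
    v ∈ closedNbhd G u ↔ v = u ∨ G.Adj u v := Iff.rfl

lemma mem_closedNbhd_comm {G : SimpleGraph V} {u v : V} :
    v ∈ closedNbhd G u ↔ u ∈ closedNbhd G v := by
  rw [mem_closedNbhd, mem_closedNbhd, G.adj_comm, eq_comm]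

lemma Twins.mem_closedNbhd_iff {G : SimpleGraph V} {u v : V} (h : Twins G u v) (w : V) :
    u ∈ closedNbhd G w ↔ v ∈ closedNbhd G w := by
  rw [mem_closedNbhd_comm, mem_closedNbhd_comm (u := w), show closedNbhd G u = _ from h]

lemma mem_closedNbhd_induce {G : SimpleGraph V} {s : Set V} {u v : s} :
    v ∈ closedNbhd (G.induce s) u ↔ (v : V) ∈ closedNbhd G u := by
  simp [mem_closedNbhd, Subtype.ext_iff]

/-- An injective coloring is locally identifying. -/
lemma isLidColoring_of_injective {α : Type*} (G : SimpleGraph V) {c : V → α}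
    (hc : Function.Injective c) : IsLidColoring G c :=
  ⟨fun _ _ h he => h.ne (hc he), fun _ _ _ ht he => ht (hc.image_injective he)⟩

/-- A lid-coloring remains one after an injective renaming of the colors. -/
lemma IsLidColoring.comp_injective {α β : Type*} {G : SimpleGraph V} {c : V → α}
    (h : IsLidColoring G c) {f : α → β} (hf : Function.Injective f) :
    IsLidColoring G (f ∘ c) := by
  refine ⟨fun u v huv he => h.1 u v huv (hf he), fun u v huv ht he => h.2 u v huv ht ?_⟩
  rw [Set.image_comp, Set.image_comp] at he
  exact hf.image_injective he

lemma IsLidColoring.chiLid_le_card {α : Type*} [Fintype α] {G : SimpleGraph V} {c : V → α}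
    (h : IsLidColoring G c) : chiLid G ≤ Fintype.card α :=
  Nat.sInf_le ⟨_, h.comp_injective (Fintype.equivFin α).injective⟩

/-- The minimum defining `chiLid` is attained on a finite graph. -/
lemma exists_isLidColoring_chiLid [Finite V] (G : SimpleGraph V) :
    ∃ c : V → Fin (chiLid G), IsLidColoring G c := by
  have : Fintype V := Fintype.ofFinite V
  exact Nat.sInf_mem (s := {n | ∃ c : V → Fin n, IsLidColoring G c})
    ⟨_, _, isLidColoring_of_injective G (Fintype.equivFin V).injective⟩

open Classical in
/-- Extend a coloring of `s` by giving each vertex outside `s` a color of its own. -/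
noncomputable def extendColoring {α : Type*} (s : Finset V) (c : (↑s : Set V) → α) (v : V) :
    α ⊕ {v : V // v ∉ s} :=
  if h : v ∈ s then Sum.inl (c ⟨v, h⟩) else Sum.inr ⟨v, h⟩

lemma inl_mem_image_extendColoring {α : Type*} {G : SimpleGraph V} {s : Finset V}
    (c : (↑s : Set V) → α) {u : V} {w : (↑s : Set V)} (h : Twins G u w) (a : α) :
    Sum.inl a ∈ extendColoring s c '' closedNbhd G u ↔
      a ∈ c '' closedNbhd (G.induce (↑s : Set V)) w := by
  rw [show closedNbhd G u = _ from h]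
  constructor
  · rintro ⟨x, hx, he⟩
    by_cases hxs : x ∈ s
    · exact ⟨⟨x, hxs⟩, mem_closedNbhd_induce.2 hx, by simpa [extendColoring, hxs] using he⟩
    · simp [extendColoring, hxs] at he
  · rintro ⟨⟨x, hxs⟩, hx, rfl⟩
    exact ⟨x, mem_closedNbhd_induce.1 hx, dif_pos hxs⟩

/-- Vertices of a representative set that are twins in the induced subgraph are twins in `G`. -/
lemma IsRepSet.twins_of_induce {G : SimpleGraph V} {s : Finset V} (hs : IsRepSet G s)
    {u v : (↑s : Set V)} (h : Twins (G.induce (↑s : Set V)) u v) : Twins G u v := by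
  ext x
  obtain ⟨w, ⟨hw, hxw⟩, -⟩ := hs x
  rw [hxw.mem_closedNbhd_iff, hxw.mem_closedNbhd_iff]
  have := Set.ext_iff.1 h ⟨w, hw⟩
  rwa [mem_closedNbhd_induce, mem_closedNbhd_induce] at this

lemma IsRepSet.isLidColoring_extendColoring {α : Type*} {G : SimpleGraph V} {s : Finset V}
    (hs : IsRepSet G s) {c : (↑s : Set V) → α}
    (hc : IsLidColoring (G.induce (↑s : Set V)) c) :
    IsLidColoring G (extendColoring s c) := by
  refine ⟨fun u v huv he => ?_, fun u v huv ht he => ?_⟩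
  · by_cases hu : u ∈ s <;> by_cases hv : v ∈ s <;> simp [extendColoring, hu, hv] at he
    · exact hc.1 ⟨u, hu⟩ ⟨v, hv⟩ huv he
    · exact huv.ne he
  · obtain ⟨u', ⟨hu', huu'⟩, -⟩ := hs u
    obtain ⟨v', ⟨hv', hvv'⟩, -⟩ := hs v
    have hne : ¬ Twins G u' v' := fun h => ht ((huu'.trans h).trans hvv'.symm)
    have hmem : v' ∈ closedNbhd G u' := by
      rw [← show closedNbhd G u = _ from huu', ← hvv'.mem_closedNbhd_iff]
      exact Or.inr huv
    have hadj : G.Adj u' v' := by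
      rcases hmem with h | h
      · exact absurd (h ▸ rfl) hne
      · exact h
    refine hc.2 ⟨u', hu'⟩ ⟨v', hv'⟩ hadj (fun h => hne (hs.twins_of_induce h)) ?_
    ext a
    rw [← inl_mem_image_extendColoring c huu', ← inl_mem_image_extendColoring c hvv', he]

lemma mem_twinClass [Fintype V] {G : SimpleGraph V} {u v : V} :
    v ∈ twinClass G u ↔ Twins G u v := by
  simp [twinClass]

/-- There are at most `(T(G) - 1) · t(G)` vertices outside a representative set. -/
lemma IsRepSet.card_compl_le [Fintype V] {G : SimpleGraph V} {s : Finset V}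
    [Fintype {v : V // v ∉ s}]
    (hs : IsRepSet G s) :
    Fintype.card {v : V // v ∉ s} ≤ (maxTwinClass G - 1) * numBigTwinClasses G := by
  classical
  rw [Fintype.card_subtype]
  unfold numBigTwinClasses
  refine Finset.card_le_mul_card_image_of_maps_to (f := twinClass G) (fun v hv => ?_) _
    fun Q hQ => ?_
  · obtain ⟨w, ⟨hw, hvw⟩, -⟩ := hs v
    have hvs : v ∉ s := by simpa using hv
    refine Finset.mem_filter.2 ⟨Finset.mem_image_of_mem _ (Finset.mem_univ v), ?_⟩
    exact Finset.one_lt_card.2 ⟨v, mem_twinClass.2 rfl, w, mem_twinClass.2 hvw,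
      fun h => hvs (h ▸ hw)⟩
  · obtain ⟨v, -, rfl⟩ := Finset.mem_image.1 (Finset.mem_filter.1 hQ).1
    obtain ⟨w, ⟨hw, hvw⟩, -⟩ := hs v
    calc _ ≤ ((twinClass G v).erase w).card := by
          refine Finset.card_le_card fun x hx => ?_
          obtain ⟨hxs, hxv⟩ := Finset.mem_filter.1 hx
          refine Finset.mem_erase.2 ⟨fun h => (Finset.mem_filter.1 hxs).2 (h ▸ hw), ?_⟩
          exact hxv ▸ mem_twinClass.2 rfl
      _ = (twinClass G v).card - 1 := Finset.card_erase_of_mem (mem_twinClass.2 hvw)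
      _ ≤ maxTwinClass G - 1 := Nat.sub_le_sub_right
          (Finset.le_sup (f := fun v => (twinClass G v).card) (Finset.mem_univ v)) 1

/-- For every finite simple graph `G`,
`χ_lid(G) ≤ χ_lid(G\R) + (T(G) - 1) · t(G)`. -/
theorem chiLid_le_chiLid_quotient_add [Fintype V] (G : SimpleGraph V)
    (s : Finset V) (hs : IsRepSet G s) :
    chiLid G ≤ chiLid (G.induce (↑s : Set V))
      + (maxTwinClass G - 1) * numBigTwinClasses G := by
  classical
  obtain ⟨c, hc⟩ := exists_isLidColoring_chiLid (G.induce (↑s : Set V))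
  calc chiLid G ≤ _ := (hs.isLidColoring_extendColoring hc).chiLid_le_card
    _ = chiLid (G.induce (↑s : Set V)) + Fintype.card {v : V // v ∉ s} := by simp
    _ ≤ _ := Nat.add_le_add_left hs.card_compl_le _
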